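/- Let 1 < β < 2, M ≥ 2 an integer, μ₀ > 0, K > 0 and ν_β > 0, and set A = μ₀·I + K·ν_β·G_β and R = μ₀·I + K·ν_β·r(G_β). Then the smallest singular value of the preconditioned matrix R⁻¹·A is bounded away from zero: for every nonzero x ∈ ℝ^{M−1}, ‖R⁻¹·A·x‖₂ > (μ₀/(μ₀ + 2·K·ν_β·ĝ₀^{(β)}))·‖x‖₂. -/

import Mathlib

/-- Fractional centered difference coefficients `ĝ_k^{(β)}`. -/
noncomputable def ghat (β : ℝ) (k : ℤ) : ℝ :=
  (-1 : ℝ) ^ k * Real.Gamma (β + 1) /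
    (Real.Gamma (β / 2 - k + 1) * Real.Gamma (β / 2 + k + 1))

/-- The `(M−1)×(M−1)` symmetric Toeplitz matrix `G_β`. -/
noncomputable def Gmat (β : ℝ) (M : ℕ) : Matrix (Fin (M - 1)) (Fin (M - 1)) ℝ :=
  Matrix.of fun i j => ghat β ((i : ℤ) - (j : ℤ))

/-- First column of the circulant approximation `r(G_β)`. -/
noncomputable def rcol (β : ℝ) (M : ℕ) (k : ℕ) : ℝ :=
  if k = 0 then ghat β 0 else ghat β k + ghat β ((k : ℤ) - ((M : ℤ) - 1))

/-- The `(M−1)×(M−1)` circulant matrix `r(G_β)`. -/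
noncomputable def circG (β : ℝ) (M : ℕ) : Matrix (Fin (M - 1)) (Fin (M - 1)) ℝ :=
  Matrix.of fun i j => rcol β M ((((i : ℤ) - (j : ℤ)) % ((M : ℤ) - 1)).toNat)

/-- The constant `c_*^{(β)} = (2/β) r_β`. -/
noncomputable def cstar (β : ℝ) : ℝ :=
  (2 / β) * (Real.exp (-2) * ((4 - β) * (2 - β) * β) / ((6 + β) * (4 + β) * (2 + β)) *
    (Real.Gamma (β + 1) / (Real.Gamma (β / 2 + 1)) ^ 2) * (3 + β / 2) ^ (β + 1))

/-- Grünwald coefficients `g_k^{(γ)}`. -/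
noncomputable def gcoef (γ : ℝ) : ℕ → ℝ
  | 0 => 1
  | (k + 1) => (1 - (γ + 1) / (k + 1)) * gcoef γ k

/-- Weighted and shifted Grünwald coefficients `λ_k^{(γ)}`. -/
noncomputable def lamc (γ : ℝ) : ℕ → ℝ
  | 0 => 1 + γ / 2
  | (k + 1) => (1 + γ / 2) * gcoef γ (k + 1) - (γ / 2) * gcoef γ k

theorem ghat_rec (β : ℝ) (hβ1 : 1 < β) (hβ2 : β < 2) (k : ℕ) :
    ghat β ((k + 1 : ℕ) : ℤ) * (β / 2 + k + 1) = (k - β / 2) * ghat β (k : ℤ) := by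
  have h1 : β / 2 - k ≠ 0 := by
    rcases Nat.eq_zero_or_pos k with h | h
    · subst h; simp; linarith
    · have : (1 : ℝ) ≤ k := by exact_mod_cast h
      intro h; linarith
  have h2 : β / 2 + k + 1 ≠ 0 := by positivity
  unfold ghat
  have e1 := Real.Gamma_add_one h1
  have e2 := Real.Gamma_add_one h2
  push_cast
  have e3 : β / 2 - ((k : ℝ) + 1) + 1 = β / 2 - k := by ring
  have e4 : β / 2 + ((k : ℝ) + 1) + 1 = β / 2 + k + 1 + 1 := by ring
  rw [e3, e4, e1, e2, zpow_add_one₀ (by norm_num)]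
  generalize Real.Gamma (β / 2 - k) = X
  generalize Real.Gamma (β / 2 + k + 1) = Y
  have e5 : (k : ℝ) - β / 2 = -(β / 2 - k) := by ring
  rw [e5]
  generalize β / 2 - (k : ℝ) = D at h1 ⊢
  generalize β / 2 + (k : ℝ) + 1 = E at h2 ⊢
  by_cases hX : X = 0
  · simp [hX]
  by_cases hY : Y = 0
  · simp [hY]
  field_simp

theorem ghat_zero_pos (β : ℝ) (hβ1 : 1 < β) : 0 < ghat β 0 := by
  unfold ghat
  have h1 : 0 < Real.Gamma (β + 1) := Real.Gamma_pos_of_pos (by linarith)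
  have h2 : 0 < Real.Gamma (β / 2 + 1) := Real.Gamma_pos_of_pos (by linarith)
  simp
  positivity

theorem ghat_neg_pos (β : ℝ) (hβ1 : 1 < β) (hβ2 : β < 2) (k : ℕ) :
    ghat β ((k + 1 : ℕ) : ℤ) < 0 := by
  induction k with
  | zero =>
    have h := ghat_rec β hβ1 hβ2 0
    have h0 := ghat_zero_pos β hβ1
    simp at h ⊢
    nlinarith
  | succ k ih =>
    have h := ghat_rec β hβ1 hβ2 (k + 1)
    push_cast at h ih ⊢
    have hk : (0 : ℝ) ≤ k := by positivity
    have : ((k : ℝ) + 1 - β / 2) * ghat β ((k : ℤ) + 1) < 0 :=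
      mul_neg_of_pos_of_neg (by linarith) ih
    rw [← h] at this
    exact neg_of_mul_neg_left this (by linarith)

theorem ghat_even (β : ℝ) (k : ℤ) : ghat β (-k) = ghat β k := by
  unfold ghat
  push_cast
  rw [zpow_neg, ← inv_zpow, mul_comm (Real.Gamma _)]
  norm_num
  ring_nf

theorem ghat_partial (β : ℝ) (hβ1 : 1 < β) (hβ2 : β < 2) (n : ℕ) :
    ghat β 0 + 2 * ∑ k ∈ Finset.range n, ghat β ((k + 1 : ℕ) : ℤ)
      = (1 - n / (β / 2)) * ghat β (n : ℤ) := by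
  induction n with
  | zero => simp
  | succ n ih =>
    have h := ghat_rec β hβ1 hβ2 n
    have hb : β ≠ 0 := by linarith
    rw [Finset.sum_range_succ, mul_add, ← add_assoc, ih]
    have e : (1 - (n : ℝ) / (β / 2)) * ghat β n = -(2 / β) * ((n - β / 2) * ghat β n) := by
      field_simp; ring
    rw [e, ← h]
    push_cast
    field_simp
    ring

theorem ghat_partial_pos (β : ℝ) (hβ1 : 1 < β) (hβ2 : β < 2) (n : ℕ) :
    0 < ghat β 0 + 2 * ∑ k ∈ Finset.range n, ghat β ((k + 1 : ℕ) : ℤ) := by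
  cases n with
  | zero => simpa using ghat_zero_pos β hβ1
  | succ n =>
    rw [ghat_partial β hβ1 hβ2]
    refine mul_pos_of_neg_of_neg ?_ (ghat_neg_pos β hβ1 hβ2 n)
    have hn : (0 : ℝ) ≤ n := by positivity
    rw [sub_neg, lt_div_iff₀ (by linarith)]
    push_cast; linarith

theorem ghat_nonpos (β : ℝ) (hβ1 : 1 < β) (hβ2 : β < 2) (k : ℤ) (hk : k ≠ 0) :
    ghat β k < 0 := by
  have key : ∀ j : ℤ, 0 < j → ghat β j < 0 := by
    intro j hj
    obtain ⟨n, rfl⟩ : ∃ n : ℕ, j = ((n + 1 : ℕ) : ℤ) := ⟨(j - 1).toNat, by omega⟩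
    exact ghat_neg_pos β hβ1 hβ2 n
  rcases lt_or_gt_of_ne hk with h | h
  · rw [← ghat_even]; exact key _ (by omega)
  · exact key _ h

theorem rcol_sum (β : ℝ) (hβ1 : 1 < β) (hβ2 : β < 2) (m : ℕ) :
    ∑ k : Fin (m + 1), |rcol β (m + 2) k| < 2 * ghat β 0 := by
  rw [Fin.sum_univ_eq_sum_range (fun k => |rcol β (m + 2) k|) (m + 1), Finset.sum_range_succ']
  have e0 : |rcol β (m + 2) 0| = ghat β 0 := by
    simp [rcol, abs_of_pos (ghat_zero_pos β hβ1)]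
  have e1 : ∀ k ∈ Finset.range m, |rcol β (m + 2) (k + 1)|
      = -ghat β ((k + 1 : ℕ) : ℤ) + -ghat β ((m - 1 - k + 1 : ℕ) : ℤ) := by
    intro k hk
    rw [Finset.mem_range] at hk
    have e : (((k + 1 : ℕ) : ℤ) - (((m + 2 : ℕ) : ℤ) - 1)) = -((m - 1 - k + 1 : ℕ) : ℤ) := by
      omega
    rw [rcol, if_neg (by omega), e, ghat_even, abs_of_neg]
    · ring
    · have := ghat_neg_pos β hβ1 hβ2 k
      have := ghat_neg_pos β hβ1 hβ2 (m - 1 - k)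
      linarith
  rw [e0, Finset.sum_congr rfl e1, Finset.sum_add_distrib,
    Finset.sum_range_reflect (fun k => -ghat β ((k + 1 : ℕ) : ℤ)) m, Finset.sum_neg_distrib]
  have := ghat_partial_pos β hβ1 hβ2 m
  linarith

theorem circ_entry (β : ℝ) (m : ℕ) (i j : Fin (m + 1)) :
    circG β (m + 2) i j = rcol β (m + 2) ((i - j : Fin (m + 1)) : ℕ) := by
  have hi := i.2
  have hj := j.2
  change rcol β (m + 2) ((((i : ℤ) - (j : ℤ)) % (((m + 2 : ℕ) : ℤ) - 1)).toNat) = _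
  congr 1
  have e : (((m + 2 : ℕ) : ℤ) - 1) = (m + 1 : ℤ) := by push_cast; ring
  rw [e, Fin.val_sub]
  zify
  rw [Int.toNat_of_nonneg (Int.emod_nonneg _ (by omega))]
  have : ((m + 1 - (j : ℕ) + (i : ℕ) : ℕ) : ℤ) = (i - j : ℤ) + (m + 1 : ℤ) := by omega
  push_cast at this ⊢
  rw [this, Int.add_emod_right]

theorem circ_row (β : ℝ) (hβ1 : 1 < β) (hβ2 : β < 2) (m : ℕ) (i : Fin (m + 1)) :
    ∑ j : Fin (m + 1), |circG β (m + 2) i j| < 2 * ghat β 0 := by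
  simp_rw [circ_entry]
  have h := Equiv.sum_comp (Equiv.subLeft i) (fun k : Fin (m + 1) => |rcol β (m + 2) k|)
  simp only [Equiv.subLeft_apply] at h
  rw [h]
  exact rcol_sum β hβ1 hβ2 m

theorem circ_col (β : ℝ) (hβ1 : 1 < β) (hβ2 : β < 2) (m : ℕ) (j : Fin (m + 1)) :
    ∑ i : Fin (m + 1), |circG β (m + 2) i j| < 2 * ghat β 0 := by
  simp_rw [circ_entry]
  have h := Equiv.sum_comp (Equiv.subRight j) (fun k : Fin (m + 1) => |rcol β (m + 2) k|)
  simp only [Equiv.subRight_apply] at h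
  rw [h]
  exact rcol_sum β hβ1 hβ2 m

theorem circ_diag (β : ℝ) (m : ℕ) (i : Fin (m + 1)) :
    circG β (m + 2) i i = ghat β 0 := by
  rw [circ_entry]; simp [rcol]

theorem toep_le (β : ℝ) (hβ1 : 1 < β) (hβ2 : β < 2) (m : ℕ) (i j : Fin (m + 1)) :
    |Gmat β (m + 2) i j| ≤ |circG β (m + 2) i j| := by
  have hi := i.2
  have hj := j.2
  change |ghat β ((i : ℤ) - (j : ℤ))| ≤
    |rcol β (m + 2) ((((i : ℤ) - (j : ℤ)) % (((m + 2 : ℕ) : ℤ) - 1)).toNat)|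
  have e : (((m + 2 : ℕ) : ℤ) - 1) = (m + 1 : ℤ) := by push_cast; ring
  rw [rcol, e]
  rcases lt_trichotomy (i : ℕ) (j : ℕ) with h | h | h
  · have : ((i : ℤ) - (j : ℤ)) % (m + 1 : ℤ) = i - j + (m + 1) := by
      rw [← Int.add_emod_right, Int.emod_eq_of_lt (by omega) (by omega)]
    rw [this, if_neg (by omega), Int.toNat_of_nonneg (by omega)]
    have a1 := ghat_nonpos β hβ1 hβ2 ((i : ℤ) - j) (by omega)
    have a2 := ghat_nonpos β hβ1 hβ2 ((i : ℤ) - j + (m + 1)) (by omega)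
    rw [add_sub_cancel_right, abs_of_neg a1, abs_of_neg (by linarith)]
    linarith
  · simp [h]
  · have : ((i : ℤ) - (j : ℤ)) % (m + 1 : ℤ) = i - j :=
      Int.emod_eq_of_lt (by omega) (by omega)
    rw [this, if_neg (by omega), Int.toNat_of_nonneg (by omega)]
    have a1 := ghat_nonpos β hβ1 hβ2 ((i : ℤ) - j) (by omega)
    have a2 := ghat_nonpos β hβ1 hβ2 ((i : ℤ) - j - (m + 1)) (by omega)
    rw [abs_of_neg a1, abs_of_neg (by linarith)]
    linarith

theorem quad_pos {n : ℕ} (B : Matrix (Fin n) (Fin n) ℝ) (d : ℝ)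
    (hd : ∀ i, B i i = d) (hd0 : 0 < d) (hr : ∀ i, ∑ j, |B i j| < 2 * d)
    (hc : ∀ j, ∑ i, |B i j| < 2 * d) (x : Fin n → ℝ) :
    0 ≤ ∑ i, x i * (B.mulVec x) i := by
  have h1 : ∀ i j, (if i = j then 2 * d * x i ^ 2 else 0)
      - |B i j| * x i ^ 2 / 2 - |B i j| * x j ^ 2 / 2 ≤ x i * (B i j * x j) := by
    intro i j
    split_ifs with h
    · subst h
      rw [hd, abs_of_pos hd0]; nlinarith
    · have a := abs_nonneg (B i j)
      rcases abs_cases (B i j) with ⟨b, _⟩ | ⟨b, _⟩ <;> rw [b] at a ⊢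
      · nlinarith [mul_nonneg a (sq_nonneg (x i + x j))]
      · nlinarith [mul_nonneg a (sq_nonneg (x i - x j))]
  have h2 : ∑ i, x i * (B.mulVec x) i = ∑ i, ∑ j, x i * (B i j * x j) := by
    simp [Matrix.mulVec, dotProduct, Finset.mul_sum]
  have h3 : ∑ i, ∑ j, |B i j| * x i ^ 2 / 2 ≤ ∑ i, d * x i ^ 2 := by
    refine Finset.sum_le_sum fun i _ => ?_
    rw [← Finset.sum_div, ← Finset.sum_mul]
    nlinarith [mul_le_mul_of_nonneg_right (hr i).le (sq_nonneg (x i))]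
  have h4 : ∑ i, ∑ j, |B i j| * x j ^ 2 / 2 ≤ ∑ i, d * x i ^ 2 := by
    rw [Finset.sum_comm]
    refine Finset.sum_le_sum fun i _ => ?_
    rw [← Finset.sum_div, ← Finset.sum_mul]
    nlinarith [mul_le_mul_of_nonneg_right (hc i).le (sq_nonneg (x i))]
  have h5 := Finset.sum_le_sum fun i (_ : i ∈ Finset.univ) =>
    Finset.sum_le_sum fun j (_ : j ∈ Finset.univ) => h1 i j
  rw [← h2] at h5
  simp only [Finset.sum_sub_distrib] at h5
  have h6 : ∑ i, ∑ j, (if i = j then 2 * d * x i ^ 2 else 0) = 2 * ∑ i, d * x i ^ 2 := by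
    simp [Finset.mul_sum, mul_assoc]
  rw [h6] at h5
  linarith

theorem schur_lt {n : ℕ} (B : Matrix (Fin n) (Fin n) ℝ) (s : ℝ)
    (hr : ∀ i, ∑ j, |B i j| < s) (hc : ∀ j, ∑ i, |B i j| < s)
    (y : Fin n → ℝ) (hy : y ≠ 0) :
    ∑ i, (B.mulVec y i) ^ 2 < s ^ 2 * ∑ i, y i ^ 2 := by
  obtain ⟨i0, hi0⟩ := Function.ne_iff.mp hy
  have hs : 0 < s := lt_of_le_of_lt (Finset.sum_nonneg fun j _ => abs_nonneg _) (hr i0)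
  have h1 : ∀ i, (B.mulVec y i) ^ 2 ≤ s * ∑ j, |B i j| * y j ^ 2 := by
    intro i
    have := Finset.sum_sq_le_sum_mul_sum_of_sq_le_mul Finset.univ
      (r := fun j => B i j * y j) (f := fun j => |B i j|) (g := fun j => |B i j| * y j ^ 2)
      (fun j _ => abs_nonneg _) (fun j _ => by positivity)
      (fun j _ => le_of_eq (by rw [mul_pow, ← sq_abs (B i j)]; ring))
    refine le_trans this (mul_le_mul_of_nonneg_right (hr i).le ?_)
    exact Finset.sum_nonneg fun j _ => by positivity
  have h2 : ∑ i, ∑ j, |B i j| * y j ^ 2 < s * ∑ j, y j ^ 2 := by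
    rw [Finset.sum_comm, Finset.mul_sum]
    refine Finset.sum_lt_sum (fun j _ => ?_) ⟨i0, Finset.mem_univ _, ?_⟩
    · rw [← Finset.sum_mul]
      exact mul_le_mul_of_nonneg_right (hc j).le (sq_nonneg _)
    · rw [← Finset.sum_mul]
      exact mul_lt_mul_of_pos_right (hc i0) ((sq_pos_iff.mpr hi0))
  calc _ ≤ ∑ i, s * ∑ j, |B i j| * y j ^ 2 := Finset.sum_le_sum fun i _ => h1 i
    _ = s * ∑ i, ∑ j, |B i j| * y j ^ 2 := by rw [Finset.mul_sum]
    _ < s * (s * ∑ j, y j ^ 2) := mul_lt_mul_of_pos_left h2 hs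
    _ = _ := by ring

/-- the smallest singular value of `R⁻¹ A` is bounded away from zero:
`‖R⁻¹ A x‖₂ > (μ₀/(μ₀ + 2 K ν_β ĝ₀^{(β)})) ‖x‖₂` for every nonzero `x`. -/
theorem stmt6 (β : ℝ) (hβ1 : 1 < β) (hβ2 : β < 2) (M : ℕ) (hM : 2 ≤ M)
    (μ₀ K νβ : ℝ) (hμ : 0 < μ₀) (hK : 0 < K) (hν : 0 < νβ) :
    let A : Matrix (Fin (M - 1)) (Fin (M - 1)) ℝ :=
      μ₀ • (1 : Matrix (Fin (M - 1)) (Fin (M - 1)) ℝ) + (K * νβ) • Gmat β M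
    let R : Matrix (Fin (M - 1)) (Fin (M - 1)) ℝ :=
      μ₀ • (1 : Matrix (Fin (M - 1)) (Fin (M - 1)) ℝ) + (K * νβ) • circG β M
    ∀ x : Fin (M - 1) → ℝ, x ≠ 0 →
      μ₀ / (μ₀ + 2 * K * νβ * ghat β 0) * Real.sqrt (∑ i, x i ^ 2) <
        Real.sqrt (∑ i, (R⁻¹.mulVec (A.mulVec x)) i ^ 2) := by
  intro A R x hx
  obtain ⟨m, rfl⟩ : ∃ m, M = m + 2 := ⟨M - 2, by omega⟩
  change Fin (m + 1) → ℝ at x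
  have hg := ghat_zero_pos β hβ1
  set d := ghat β 0 with hd
  set c := K * νβ with hcdef
  have hc : 0 < c := mul_pos hK hν
  have hs : 0 < μ₀ + 2 * c * d := by positivity
  have hentry : ∀ i j : Fin (m + 1), |R i j| ≤ (if i = j then μ₀ else 0) + c * |circG β (m + 2) i j| := by
    intro i j
    have : R i j = (if i = j then μ₀ else 0) + c * circG β (m + 2) i j := by
      simp [R, Matrix.one_apply, hcdef]
    rw [this]
    refine (abs_add_le _ _).trans ?_
    rw [abs_mul, abs_of_pos hc]
    split_ifs <;> simp [abs_of_pos hμ]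
  have hRr : ∀ i : Fin (m + 1), ∑ j : Fin (m + 1), |R i j| < μ₀ + 2 * c * d := by
    intro i
    refine (Finset.sum_le_sum fun j _ => hentry i j).trans_lt ?_
    rw [Finset.sum_add_distrib, ← Finset.mul_sum]
    have := mul_lt_mul_of_pos_left (circ_row β hβ1 hβ2 m i) hc
    simp
    linarith
  have hRc : ∀ j : Fin (m + 1), ∑ i : Fin (m + 1), |R i j| < μ₀ + 2 * c * d := by
    intro j
    refine (Finset.sum_le_sum fun i _ => hentry i j).trans_lt ?_
    rw [Finset.sum_add_distrib, ← Finset.mul_sum]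
    have := mul_lt_mul_of_pos_left (circ_col β hβ1 hβ2 m j) hc
    simp
    linarith
  have hdet : R.det ≠ 0 := by
    refine det_ne_zero_of_sum_row_lt_diag (fun i => ?_)
    change Fin (m + 1) at i
    have hdiag : R i i = μ₀ + c * d := by
      have := circ_diag β m i
      simp [R, this, hd, hcdef]
    have h1 := hRr i
    have h2 := Finset.add_sum_erase Finset.univ (fun j => |R i j|) (Finset.mem_univ i)
    simp only [Real.norm_eq_abs]
    have h3 : |R i i| = μ₀ + c * d := by rw [hdiag, abs_of_pos (by positivity)]
    have h4 : ∑ j : Fin (m + 1), |R i j| < 2 * |R i i| := by rw [h3]; linarith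
    have h2' : |R i i| + ∑ j ∈ Finset.univ.erase i, |R i j| = ∑ j : Fin (m + 1), |R i j| := h2
    have h5 : ∑ j ∈ Finset.univ.erase i, |R i j| < |R i i| := by linarith
    exact h5
  have hq : 0 ≤ ∑ i : Fin (m + 1), x i * ((Gmat β (m + 2)).mulVec x) i := by
    refine quad_pos (n := m + 1) (Gmat β (m + 2)) d (fun i => ?_) hg (fun i => ?_) (fun j => ?_) x
    · simp [Gmat, hd]
    · exact (Finset.sum_le_sum fun j _ => toep_le β hβ1 hβ2 m i j).trans_lt
        (circ_row β hβ1 hβ2 m i)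
    · exact (Finset.sum_le_sum fun i _ => toep_le β hβ1 hβ2 m i j).trans_lt
        (circ_col β hβ1 hβ2 m j)
  have hA : ∀ i : Fin (m + 1), A.mulVec x i = μ₀ * x i + c * (Gmat β (m + 2)).mulVec x i := by
    intro i
    simp [A, Matrix.add_mulVec, Matrix.smul_mulVec, hcdef]
  have hAx : μ₀ ^ 2 * ∑ i : Fin (m + 1), x i ^ 2 ≤ ∑ i : Fin (m + 1), (A.mulVec x i) ^ 2 := by
    have h1 : ∑ i : Fin (m + 1), (μ₀ ^ 2 * x i ^ 2
        + 2 * μ₀ * c * (x i * ((Gmat β (m + 2)).mulVec x) i))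
        ≤ ∑ i : Fin (m + 1), (A.mulVec x i) ^ 2 := by
      refine Finset.sum_le_sum fun i _ => ?_
      rw [hA]
      nlinarith [sq_nonneg (c * (Gmat β (m + 2)).mulVec x i)]
    rw [Finset.sum_add_distrib, ← Finset.mul_sum, ← Finset.mul_sum] at h1
    have : 0 ≤ 2 * μ₀ * c * ∑ i : Fin (m + 1), x i * ((Gmat β (m + 2)).mulVec x) i := by
      positivity
    linarith
  have hxpos : 0 < ∑ i : Fin (m + 1), x i ^ 2 := by
    obtain ⟨i0, hi0⟩ := Function.ne_iff.mp hx
    refine Finset.sum_pos' (fun i _ => sq_nonneg _) ⟨i0, Finset.mem_univ _, ?_⟩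
    have : x i0 ≠ 0 := hi0
    positivity
  set y := R⁻¹.mulVec (A.mulVec x) with hydef
  have hRy : R.mulVec y = A.mulVec x := by
    rw [hydef, Matrix.mulVec_mulVec, Matrix.mul_nonsing_inv R (isUnit_iff_ne_zero.mpr hdet),
      Matrix.one_mulVec]
  have hy : y ≠ 0 := by
    intro h
    rw [h, Matrix.mulVec_zero] at hRy
    rw [← hRy] at hAx
    simp at hAx
    have : 0 < μ₀ ^ 2 * ∑ i : Fin (m + 1), x i ^ 2 := by positivity
    linarith
  have hfin := schur_lt (n := m + 1) R (μ₀ + 2 * c * d) hRr hRc y hy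
  have hlt : μ₀ ^ 2 * ∑ i : Fin (m + 1), x i ^ 2
      < (μ₀ + 2 * c * d) ^ 2 * ∑ i : Fin (m + 1), y i ^ 2 := by
    refine lt_of_le_of_lt hAx ?_
    rw [← hRy]; exact hfin
  have hlt2 := Real.sqrt_lt_sqrt (by positivity) hlt
  rw [Real.sqrt_mul (sq_nonneg _), Real.sqrt_mul (sq_nonneg _), Real.sqrt_sq hμ.le,
    Real.sqrt_sq hs.le] at hlt2
  have e : 2 * K * νβ * d = 2 * c * d := by rw [hcdef]; ring
  rw [e, div_mul_eq_mul_div, div_lt_iff₀ hs, mul_comm (Real.sqrt _) (μ₀ + 2 * c * d)]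
  exact hlt2
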